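/- Let A be a unital C*-algebra with A ≠ {0}, and let L be a *-seminorm on A (with values in [0,∞]) such that L(1) = 0. Define ρ_L on the state space S(A) by ρ_L(μ, ν) = sup{|μ(a) − ν(a)| : a ∈ A, a* = a, L(a) ≤ 1}. Assume that ρ_L is a finite-valued metric on S(A) and that the topology it induces on S(A) coincides with the weak-* topology. Then the set {a ∈ A : L(a) < ∞} is dense in A. -/

import Mathlib

open scoped ENNReal ComplexOrder

/-- A `[0,∞]`-valued seminorm on a normed algebra. -/
def IsESeminorm {A : Type*} [NormedRing A] [NormedAlgebra ℂ A] (L : A → ℝ≥0∞) : Prop :=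
  L 0 = 0 ∧ (∀ t : ℂ, t ≠ 0 → ∀ a : A, L (t • a) = (‖t‖₊ : ℝ≥0∞) * L a) ∧
    ∀ a b : A, L (a + b) ≤ L a + L b

/-- The state space of a unital C*-algebra `A`: continuous linear functionals (with the
weak-* topology) that are unital and positive. -/
def StateSp (A : Type*) [NormedRing A] [StarRing A] [NormedAlgebra ℂ A] : Type _ :=
  {μ : WeakDual ℂ A // μ 1 = 1 ∧ ∀ a : A, 0 ≤ μ (star a * a)}

instance (A : Type*) [NormedRing A] [StarRing A] [NormedAlgebra ℂ A] :
    TopologicalSpace (StateSp A) :=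
  inferInstanceAs (TopologicalSpace {μ : WeakDual ℂ A // μ 1 = 1 ∧ ∀ a : A, 0 ≤ μ (star a * a)})

/-- A real-linear functional on the self-adjoint part of a C*-algebra which is nonnegative on
nonnegative elements is the restriction of a positive continuous complex-linear functional. -/
lemma exists_positive_extension_of_selfAdjoint {A : Type*} [CStarAlgebra A] [PartialOrder A]
    [StarOrderedRing A] (f : selfAdjoint A →ₗ[ℝ] ℝ)
    (hf : ∀ x : selfAdjoint A, 0 ≤ (x : A) → 0 ≤ f x) :
    ∃ μ : A →L[ℂ] ℂ, (∀ x : selfAdjoint A, μ x = f x) ∧ ∀ a : A, 0 ≤ μ (star a * a) := by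
  let F : A →ₗ[ℂ] ℂ := Module.Dual.extendRCLike (f ∘ₗ realPart)
  have hF : ∀ x : selfAdjoint A, F x = f x := fun x => by
    simp [F, Module.Dual.extendRCLike_apply]
  have hF' : ∀ x : A, 0 ≤ x → 0 ≤ F x := fun x hx => by
    have := hF ⟨x, IsSelfAdjoint.of_nonneg hx⟩
    simp only at this
    rw [this]
    exact_mod_cast hf _ hx
  let P : A →ₚ[ℂ] ℂ := PositiveLinearMap.mk₀ F hF'
  refine ⟨⟨F, ?_⟩, hF, fun a => hF' _ (star_mul_self_nonneg a)⟩
  exact map_continuous P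

/-- A bounded real-linear functional on the self-adjoint part of a C*-algebra is, up to a factor,
the difference of two functionals which are nonnegative on nonnegative elements. -/
lemma exists_nonneg_sub_eq_two_mul {A : Type*} [CStarAlgebra A] [PartialOrder A]
    [StarOrderedRing A] [Nontrivial A] (φ : A →L[ℝ] ℝ) :
    ∃ f g : selfAdjoint A →ₗ[ℝ] ℝ, (∀ x : selfAdjoint A, 0 ≤ (x : A) → 0 ≤ f x) ∧
      (∀ x : selfAdjoint A, 0 ≤ (x : A) → 0 ≤ g x) ∧
      (∀ x, f x - g x = 2 * φ x) ∧ f 1 = φ 1 + 3 * ‖φ‖ := by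
  obtain ⟨τ, -, hτ⟩ := exists_dual_vector ℝ (1 : A) (by simp)
  replace hτ : τ 1 = 1 := by simpa using hτ
  let ι : selfAdjoint A →ₗ[ℝ] A := (selfAdjoint.submodule ℝ A).subtype
  let s : PointedCone ℝ (selfAdjoint A × selfAdjoint A) :=
    { carrier := {z | 0 ≤ (z.2 : A) + z.1 ∧ 0 ≤ (z.2 : A) - z.1}
      add_mem' := by
        rintro ⟨a, b⟩ ⟨c, d⟩ ⟨h1, h2⟩ ⟨h3, h4⟩
        refine ⟨(add_nonneg h1 h3).trans_eq ?_, (add_nonneg h2 h4).trans_eq ?_⟩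
        · change (b + a + (d + c) : A) = (b + d : A) + (a + c : A); abel
        · change (b - a + (d - c) : A) = (b + d : A) - (a + c : A); abel
      zero_mem' := by simp
      smul_mem' := by
        rintro ⟨c, hc⟩ ⟨a, b⟩ ⟨h1, h2⟩
        refine ⟨(smul_nonneg hc h1).trans_eq ?_, (smul_nonneg hc h2).trans_eq ?_⟩
        · rw [smul_add]; rfl
        · rw [smul_sub]; rfl }
  let p : Submodule ℝ (selfAdjoint A × selfAdjoint A) :=
    (Submodule.span ℝ {1}).comap (LinearMap.snd ℝ _ _)
  let Φ : selfAdjoint A × selfAdjoint A →ₗ[ℝ] ℝ :=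
    ((φ : A →ₗ[ℝ] ℝ) ∘ₗ ι) ∘ₗ LinearMap.fst ℝ _ _ +
    (3 * ‖φ‖) • ((τ : A →ₗ[ℝ] ℝ) ∘ₗ ι) ∘ₗ LinearMap.snd ℝ _ _
  have hΦ : ∀ x y, Φ (x, y) = φ x + 3 * ‖φ‖ * τ y := fun _ _ => rfl
  have hone : ∀ x : selfAdjoint A, (x, (1 : selfAdjoint A)) ∈ p :=
    fun x => Submodule.mem_span_singleton_self _
  have hzero : ∀ x : selfAdjoint A, (x, (0 : selfAdjoint A)) ∈ p :=
    fun x => Submodule.zero_mem (Submodule.span ℝ {(1 : selfAdjoint A)})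
  obtain ⟨F, hF, hFs⟩ := riesz_extension s ⟨p, Φ ∘ₗ p.subtype⟩ (by
      rintro ⟨⟨x, y⟩, hxy⟩ ⟨h1, h2⟩
      obtain ⟨t, rfl⟩ := Submodule.mem_span_singleton.1 hxy
      change 0 ≤ Φ (x, t • 1)
      have e : ((t • (1 : selfAdjoint A) : selfAdjoint A) : A) = algebraMap ℝ A t := by
        rw [Algebra.algebraMap_eq_smul_one]; rfl
      simp only [e] at h1 h2
      have h12 : algebraMap ℝ A t + x ≤ algebraMap ℝ A (2 * t) := by
        rw [← sub_nonneg]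
        refine h2.trans_eq ?_
        rw [two_mul, map_add]; abel
      have ht : 0 ≤ t := by
        have := h1.trans h12
        rw [← map_zero (algebraMap ℝ A), algebraMap_le_algebraMap] at this
        linarith
      have hn : ‖algebraMap ℝ A t + x‖ ≤ 2 * t :=
        (CStarAlgebra.norm_le_iff_le_algebraMap _ (by positivity) h1).2 h12
      have hx : ‖(x : A)‖ ≤ 3 * t := by
        have := norm_sub_le (algebraMap ℝ A t + x) (algebraMap ℝ A t)
        rw [add_sub_cancel_left, norm_algebraMap', Real.norm_of_nonneg ht] at this
        linarith
      have := φ.le_opNorm x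
      have h3 := mul_le_mul_of_nonneg_left hx (norm_nonneg φ)
      have h4 := (abs_le.1 (Real.norm_eq_abs _ ▸ this)).1
      rw [hΦ, e, Algebra.algebraMap_eq_smul_one, map_smul, hτ, smul_eq_mul, mul_one]
      linarith)
    (by
      rintro ⟨u, v⟩
      refine ⟨⟨(-u, ‖v‖ • 1), 
        Submodule.smul_mem _ _ (Submodule.mem_span_singleton_self _)⟩, ?_⟩
      have := (v.2 : IsSelfAdjoint (v : A)).neg_algebraMap_norm_le_self
      rw [Algebra.algebraMap_eq_smul_one, neg_le_iff_add_nonneg'] at this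
      constructor
      · simpa using this
      · simpa using this)
  have hF1 : ∀ x, F (x, 0) = φ x := fun x => by
    rw [hF ⟨(x, 0), hzero x⟩]
    change Φ (x, 0) = _
    simp [hΦ]
  refine ⟨F ∘ₗ (LinearMap.id.prod LinearMap.id), F ∘ₗ ((-LinearMap.id).prod LinearMap.id),
    fun x hx => hFs _ ⟨?_, ?_⟩, fun x hx => hFs _ ⟨?_, ?_⟩, fun x => ?_, ?_⟩
  · simpa using add_nonneg hx hx
  · simp
  · simp
  · simpa using add_nonneg hx hx
  · change F (x, x) - F (-x, x) = _
    rw [← map_sub, ← hF1, two_mul, ← map_add]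
    congr 1
    ext <;> simp
  · change F (1, 1) = _
    rw [hF ⟨(1, 1), hone 1⟩]
    change Φ (1, 1) = _
    simp [hΦ, hτ]

/-- A bounded real-linear functional on a C*-algebra that vanishes at `1` is, on self-adjoint
elements, a multiple of a difference of two states. -/
lemma exists_states_sub_eq_mul {A : Type*} [CStarAlgebra A] [Nontrivial A] (φ : A →L[ℝ] ℝ)
    (h1 : φ 1 = 0) (hφ : φ ≠ 0) :
    ∃ μ ν : A →L[ℂ] ℂ, (μ 1 = 1 ∧ ∀ a : A, 0 ≤ μ (star a * a)) ∧
      (ν 1 = 1 ∧ ∀ a : A, 0 ≤ ν (star a * a)) ∧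
      ∃ c : ℝ, c ≠ 0 ∧ ∀ x : A, IsSelfAdjoint x → μ x - ν x = (c * φ x : ℝ) := by
  let _ := CStarAlgebra.spectralOrder A
  have := CStarAlgebra.spectralOrderedRing A
  obtain ⟨f, g, hf, hg, hfg, hf1⟩ := exists_nonneg_sub_eq_two_mul φ
  have hM : 0 < 3 * ‖φ‖ := by have := norm_pos_iff.2 hφ; positivity
  set M := 3 * ‖φ‖
  have hg1 : g 1 = M := by
    have := hfg 1
    rw [hf1, selfAdjoint.val_one, h1] at this
    linarith
  rw [h1, zero_add] at hf1
  obtain ⟨μ, hμ, hμ'⟩ := exists_positive_extension_of_selfAdjoint (M⁻¹ • f)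
    fun x hx => mul_nonneg (by positivity) (hf x hx)
  obtain ⟨ν, hν, hν'⟩ := exists_positive_extension_of_selfAdjoint (M⁻¹ • g)
    fun x hx => mul_nonneg (by positivity) (hg x hx)
  refine ⟨μ, ν, ⟨?_, hμ'⟩, ⟨?_, hν'⟩, M⁻¹ * 2, by positivity, fun x hx => ?_⟩
  · have := hμ 1
    simpa [hf1, hM.ne'] using this
  · have := hν 1
    simpa [hg1, hM.ne'] using this
  · have h2 := hμ ⟨x, hx⟩
    have h3 := hν ⟨x, hx⟩
    simp only at h2 h3
    rw [h2, h3, mul_assoc, ← hfg ⟨x, hx⟩, ← Complex.ofReal_sub, LinearMap.smul_apply,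
      LinearMap.smul_apply, ← smul_sub, smul_eq_mul]

/-- A subspace of a complex normed space is dense if every continuous functional vanishing on it
is zero. -/
lemma Submodule.dense_of_forall_strongDual_eq_zero {E : Type*} [NormedAddCommGroup E]
    [NormedSpace ℂ E] (V : Submodule ℂ E)
    (h : ∀ f : E →L[ℂ] ℂ, (∀ x ∈ V, f x = 0) → f = 0) : Dense (V : Set E) := by
  intro x
  by_contra hx
  obtain ⟨f, u, hfx, hfV⟩ := RCLike.geometric_hahn_banach_point_closed (𝕜 := ℂ)
    (V.restrictScalars ℝ).convex.closure isClosed_closure hx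
  have hf : f = 0 := by
    refine h f fun y hy => ?_
    by_contra hne
    have h0 := hfV _ (subset_closure (V.smul_mem (((u : ℂ) - 1) / f y) hy))
    rw [map_smul, smul_eq_mul, div_mul_cancel₀ _ hne] at h0
    simp at h0
    linarith
  have h0 := hfV 0 (subset_closure V.zero_mem)
  simp [hf] at h0 hfx
  linarith

/-- Let `A ≠ 0` be a unital C*-algebra and `L` a `*`-seminorm on `A` with `L(1) = 0`.  If
`ρ_L(μ, ν) = sup {|μ(a) − ν(a)| : a = a*, L(a) ≤ 1}` is a finite-valued metric on the state
space `S(A)` inducing the weak-* topology, then `{a : L(a) < ∞}` is dense in `A`. -/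
theorem dense_of_lipnorm {A : Type*} [NormedRing A] [StarRing A] [CStarRing A]
    [NormedAlgebra ℂ A] [StarModule ℂ A] [CompleteSpace A] [NormOneClass A] [Nontrivial A]
    (L : A → ℝ≥0∞) (hsem : IsESeminorm L) (hstar : ∀ a : A, L (star a) = L a)
    (hone : L 1 = 0)
    (Rho : StateSp A → StateSp A → ℝ≥0∞)
    (hRho : ∀ μ ν : StateSp A, Rho μ ν =
      ⨆ a : {a : A // IsSelfAdjoint a ∧ L a ≤ 1}, (‖μ.1 (a : A) - ν.1 (a : A)‖₊ : ℝ≥0∞))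
    (hfin : ∀ μ ν : StateSp A, Rho μ ν ≠ ⊤)
    (m : MetricSpace (StateSp A))
    (hdist : ∀ μ ν : StateSp A,
      @dist (StateSp A) m.toPseudoMetricSpace.toDist μ ν = (Rho μ ν).toReal)
    (htop : m.toPseudoMetricSpace.toUniformSpace.toTopologicalSpace
      = (inferInstance : TopologicalSpace (StateSp A))) :
    Dense {a : A | L a < ⊤} := by
  obtain ⟨h0, hsmul, hadd⟩ := hsem
  let _ : CStarAlgebra A := {}
  let V : Submodule ℂ A :=
    { carrier := {a | L a < ⊤}
      add_mem' := fun {a b} ha hb => (hadd a b).trans_lt (ENNReal.add_lt_top.2 ⟨ha, hb⟩)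
      zero_mem' := by simp [h0]
      smul_mem' := fun t a ha => by
        rcases eq_or_ne t 0 with rfl | ht
        · simp [h0]
        · change L (t • a) < ⊤
          rw [hsmul t ht]
          exact ENNReal.mul_lt_top ENNReal.coe_lt_top ha }
  refine V.dense_of_forall_strongDual_eq_zero fun f hf => ?_
  have key : ∀ x : A, IsSelfAdjoint x → f x = 0 := by
    intro x hx
    by_contra hne
    let φ : A →L[ℝ] ℝ := Complex.reCLM ∘L ((star (f x) • f).restrictScalars ℝ)
    have hφ : ∀ a, φ a = (star (f x) * f a).re := fun _ => rfl
    have hφV : ∀ a ∈ V, φ a = 0 := fun a ha => by simp [hφ, hf a ha]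
    have hφx : φ x ≠ 0 := by
      rw [hφ, Complex.star_def, Complex.conj_mul', ← Complex.ofReal_pow, Complex.ofReal_re]
      exact pow_ne_zero _ (norm_ne_zero_iff.2 hne)
    obtain ⟨μ, ν, hμ, hν, c, hc, h⟩ := exists_states_sub_eq_mul φ
      (hφV 1 (by change L 1 < ⊤; simp [hone])) (fun h => hφx (by simp [h]))
    let μ' : StateSp A := ⟨StrongDual.toWeakDual μ, hμ⟩
    let ν' : StateSp A := ⟨StrongDual.toWeakDual ν, hν⟩
    have hμν : Rho μ' ν' = 0 := by
      rw [hRho, ENNReal.iSup_eq_zero]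
      rintro ⟨a, ha, hLa⟩
      have : μ a - ν a = 0 := by
        rw [h a ha, hφV a (hLa.trans_lt ENNReal.one_lt_top)]
        simp
      change (‖μ a - ν a‖₊ : ℝ≥0∞) = 0
      simp [this]
    have heq : μ' = ν' := by
      apply m.eq_of_dist_eq_zero
      rw [hdist, hμν, ENNReal.toReal_zero]
    have hx' : μ x = ν x := congrArg (fun ω : StateSp A => ω.1 x) heq
    have := h x hx
    rw [hx', sub_self] at this
    exact mul_ne_zero hc hφx (by exact_mod_cast this.symm)
  ext x
  rw [← realPart_add_I_smul_imaginaryPart x, map_add, map_smul, key _ (realPart x).2,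
    key _ (imaginaryPart x).2]
  simp
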